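/- Suppose u solves the direct problem with reaction coefficient c satisfying c(x) ≥ 0 for all x ∈ Ω, f satisfies condition (7), and set ψ(x) = u(x,T). Then the exact coefficient satisfies the upper bound c(x) ψ(x) ≤ −(A ψ)(x) + f(x,T) for all x ∈ Ω. -/

import Mathlib

noncomputable section

/-- The plane `ℝ²`. -/
abbrev E2 : Type := EuclideanSpace ℝ (Fin 2)

/-- The elliptic operator `(A v)(x) = - div (k(x) grad v(x))`. -/
def ellOp (k : E2 → ℝ) (v : E2 → ℝ) (x : E2) : ℝ :=
  - ∑ i : Fin 2, fderiv ℝ (fun y => k y • gradient v y) x (EuclideanSpace.single i 1) i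

/-- `u` solves the direct problem on `Ω × (0,T]` with diffusion coefficient `k`,
Robin boundary coefficient `μ`, reaction coefficient `c` and right-hand side `f`:
the parabolic equation, the homogeneous initial condition and the homogeneous
Robin (third-kind) boundary condition with respect to any outward unit normal. -/
structure IsDirectSolution (Ω : Set E2) (T : ℝ) (k μ : E2 → ℝ)
    (c : E2 → ℝ) (f : E2 → ℝ → ℝ) (u : E2 → ℝ → ℝ) : Prop where
  pde : ∀ x ∈ Ω, ∀ t : ℝ, 0 < t → t ≤ T →
    deriv (u x) t + ellOp k (fun y => u y t) x + c x * u x t = f x t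
  ic : ∀ x ∈ Ω, u x 0 = 0
  robin : ∀ x ∈ frontier Ω, ∀ ν : E2, ‖ν‖ = 1 →
    (∀ y ∈ closure Ω, (inner ℝ ν (y - x) : ℝ) ≤ 0) →
    ∀ t : ℝ, 0 < t → t ≤ T →
      k x * fderiv ℝ (fun y => u y t) x ν + μ x * u x t = 0

abbrev eb (i : Fin 2) : E2 := EuclideanSpace.single i 1

lemma gradient_coord (g : E2 → ℝ) (y : E2) (i : Fin 2) :
    gradient g y i = fderiv ℝ g y (eb i) := by
  have h : inner ℝ (gradient g y) (eb i) = fderiv ℝ g y (eb i) := by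
    simp [gradient]
  rw [← h, eb, EuclideanSpace.inner_single_right]
  simp

lemma fderiv_dir_diff {g : E2 → ℝ} (hg : ContDiff ℝ (⊤ : ℕ∞) g) (d : E2) :
    Differentiable ℝ (fun y => fderiv ℝ g y d) := by
  have h : ContDiff ℝ 1 (fderiv ℝ g) :=
    hg.fderiv_right (m := 1) (by norm_cast)
  exact (h.differentiable (by norm_num)).clm_apply (differentiable_const d)

lemma ellOp_eq {k g : E2 → ℝ} {x : E2} (hk : DifferentiableAt ℝ k x)
    (hg : ContDiff ℝ (⊤ : ℕ∞) g) :
    ellOp k g x = - ∑ i : Fin 2, (fderiv ℝ k x (eb i) * fderiv ℝ g x (eb i)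
      + k x * fderiv ℝ (fun y => fderiv ℝ g y (eb i)) x (eb i)) := by
  unfold ellOp
  congr 1
  apply Finset.sum_congr rfl
  intro i _
  have hG : DifferentiableAt ℝ (gradient g) x := by
    rw [differentiableAt_euclidean]
    intro j
    have : (fun y => gradient g y j) = fun y => fderiv ℝ g y (eb j) := by
      funext y; exact gradient_coord g y j
    rw [this]
    exact fderiv_dir_diff hg _ x
  have hd : fderiv ℝ (fun y => k y • gradient g y) x =
      k x • fderiv ℝ (gradient g) x + (fderiv ℝ k x).smulRight (gradient g x) :=
    fderiv_fun_smul hk hG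
  have hp : fderiv ℝ (fun y => fderiv ℝ g y (eb i)) x (eb i)
      = (fderiv ℝ (gradient g) x (eb i)) i := by
    have : (fun y => fderiv ℝ g y (eb i)) =
        fun y => (EuclideanSpace.proj i : E2 →L[ℝ] ℝ) (gradient g y) := by
      funext y; simp [gradient_coord]
    rw [this]
    have h2 := ((EuclideanSpace.proj i : E2 →L[ℝ] ℝ).hasFDerivAt.comp x hG.hasFDerivAt).fderiv
    have h3 : fderiv ℝ (fun y => (EuclideanSpace.proj i : E2 →L[ℝ] ℝ) (gradient g y)) x =
      (EuclideanSpace.proj i : E2 →L[ℝ] ℝ).comp (fderiv ℝ (gradient g) x) := h2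
    rw [h3]; simp
  rw [hp, hd]
  simp [gradient_coord]
  ring

lemma ellOp_lin {k g₁ g₂ : E2 → ℝ} {x : E2} (a : ℝ) (hk : DifferentiableAt ℝ k x)
    (h₁ : ContDiff ℝ (⊤ : ℕ∞) g₁) (h₂ : ContDiff ℝ (⊤ : ℕ∞) g₂) :
    ellOp k (fun y => g₁ y + a * g₂ y) x = ellOp k g₁ x + a * ellOp k g₂ x := by
  have h₁' := h₁.differentiable (by simp)
  have h₂' := h₂.differentiable (by simp)
  have hF : ∀ d : E2, (fun y => fderiv ℝ (fun y => g₁ y + a * g₂ y) y d) =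
      fun y => fderiv ℝ g₁ y d + a * fderiv ℝ g₂ y d := by
    intro d; funext y
    have := ((h₁' y).hasFDerivAt.add ((h₂' y).hasFDerivAt.const_mul a)).fderiv
    have h3 : fderiv ℝ (fun y => g₁ y + a * g₂ y) y = _ := this
    rw [h3]; simp
  have hS : ∀ d : E2, fderiv ℝ (fun y => fderiv ℝ g₁ y d + a * fderiv ℝ g₂ y d) x d =
      fderiv ℝ (fun y => fderiv ℝ g₁ y d) x d + a * fderiv ℝ (fun y => fderiv ℝ g₂ y d) x d := by
    intro d
    have := ((fderiv_dir_diff h₁ d x).hasFDerivAt.add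
      ((fderiv_dir_diff h₂ d x).hasFDerivAt.const_mul a)).fderiv
    have h3 : fderiv ℝ (fun y => fderiv ℝ g₁ y d + a * fderiv ℝ g₂ y d) x = _ := this
    rw [h3]; simp
  have h12 : ContDiff ℝ (⊤ : ℕ∞) (fun y => g₁ y + a * g₂ y) := h₁.add (contDiff_const.mul h₂)
  rw [ellOp_eq hk h12, ellOp_eq hk h₁, ellOp_eq hk h₂]
  simp only [hF, hS, Fin.sum_univ_two]
  have e : ∀ d, fderiv ℝ (fun y => g₁ y + a * g₂ y) x d = fderiv ℝ g₁ x d + a * fderiv ℝ g₂ x d :=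
    fun d => congrFun (hF d) x
  rw [e, e]
  ring

lemma second_deriv_nonneg {p : ℝ → ℝ} (hp : Continuous p) (hmin : IsLocalMin p 0) :
    0 ≤ deriv (deriv p) 0 := by
  by_contra! hneg
  have hmax := isLocalMax_of_deriv_deriv_neg hneg hmin.deriv_eq_zero hp.continuousAt
  have hc : p =ᶠ[nhds 0] fun _ => p 0 := by
    filter_upwards [hmin, hmax] with s h1 h2
    exact le_antisymm h2 h1
  have h2 := hc.deriv.deriv_eq
  simp at h2
  linarith

lemma ellOp_min {k g : E2 → ℝ} {x : E2} (hk : DifferentiableAt ℝ k x) (hk0 : 0 ≤ k x)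
    (hg : ContDiff ℝ (⊤ : ℕ∞) g) (hmin : IsLocalMin g x) : ellOp k g x ≤ 0 := by
  rw [ellOp_eq hk hg]
  have hg' := hg.differentiable (by simp)
  have h0 : fderiv ℝ g x = 0 := hmin.fderiv_eq_zero
  have h2 : ∀ d : E2, 0 ≤ fderiv ℝ (fun y => fderiv ℝ g y d) x d := by
    intro d
    have hl : ∀ s : ℝ, HasDerivAt (fun s : ℝ => x + s • d) d s := by
      intro s
      simpa using ((hasDerivAt_id s).smul_const d).const_add x
    have hd1 : deriv (fun s : ℝ => g (x + s • d)) = fun s => fderiv ℝ g (x + s • d) d := by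
      funext s
      exact ((hg' (x + s • d)).hasFDerivAt.comp_hasDerivAt s (hl s)).deriv
    have hd2 : deriv (fun s : ℝ => fderiv ℝ g (x + s • d) d) 0
        = fderiv ℝ (fun y => fderiv ℝ g y d) (x + (0:ℝ) • d) d := by
      have h3 : HasFDerivAt (fun y => fderiv ℝ g y d) _ (x + (0:ℝ) • d) :=
        (fderiv_dir_diff hg d (x + (0:ℝ) • d)).hasFDerivAt
      have h4 := HasFDerivAt.comp_hasDerivAt (0:ℝ) h3 (hl 0)
      exact h4.deriv
    have hc : Continuous (fun s : ℝ => x + s • d) := by fun_prop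
    have hm : IsLocalMin (fun s : ℝ => g (x + s • d)) 0 := by
      have ht : Filter.Tendsto (fun s : ℝ => x + s • d) (nhds 0) (nhds x) := by
        simpa using hc.tendsto 0
      have := ht.eventually hmin
      filter_upwards [this] with s hs
      simpa using hs
    have := second_deriv_nonneg (hg.continuous.comp hc) hm
    have e : (g ∘ fun s : ℝ => x + s • d) = fun s : ℝ => g (x + s • d) := rfl
    rw [e, hd1, hd2] at this
    simpa using this
  simp only [h0, Fin.sum_univ_two]
  have a := mul_nonneg hk0 (h2 (eb 0))
  have b := mul_nonneg hk0 (h2 (eb 1))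
  simp
  linarith

/-- the quadratic barrier -/
def qb (x₀ : E2) (y : E2) : ℝ := ‖y - x₀‖ ^ 2

lemma qb_smooth (x₀ : E2) : ContDiff ℝ (⊤ : ℕ∞) (qb x₀) :=
  (contDiff_id.sub contDiff_const).norm_sq ℝ

lemma qb_fderiv (x₀ y d : E2) : fderiv ℝ (qb x₀) y d = 2 * inner ℝ (y - x₀) d := by
  have h : HasFDerivAt (qb x₀) _ y := ((hasFDerivAt_id y).sub_const x₀).norm_sq
  rw [h.fderiv]; simp [inner_sub_left]

lemma qb_ellOp_bound {k : E2 → ℝ} {x x₀ : E2} {C R k₂ : ℝ} (hk : DifferentiableAt ℝ k x)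
    (hC : ‖fderiv ℝ k x‖ ≤ C) (hR : ‖x - x₀‖ ≤ R) (hk2 : k x ≤ k₂) :
    -(2 * C * R + 4 * k₂) ≤ ellOp k (qb x₀) x := by
  rw [ellOp_eq hk (qb_smooth x₀)]
  have h2 : ∀ d : E2, fderiv ℝ (fun y => fderiv ℝ (qb x₀) y d) x d = 2 * inner ℝ d d := by
    intro d
    have e : (fun y => fderiv ℝ (qb x₀) y d) = fun y => 2 * inner ℝ d (y - x₀) := by
      funext y; rw [qb_fderiv, real_inner_comm]
    rw [e]
    have h : HasFDerivAt (fun y => 2 * inner ℝ d (y - x₀)) _ x :=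
      ((innerSL ℝ d).hasFDerivAt.comp x ((hasFDerivAt_id x).sub_const x₀)).const_mul 2
    rw [h.fderiv]; simp
  have hs : x - x₀ = ∑ i, (x - x₀) i • eb i := by
    ext j; fin_cases j <;> simp [Fin.sum_univ_two]
  have hk' : fderiv ℝ k x (x - x₀) ≤ C * R := by
    refine (le_abs_self _).trans (((fderiv ℝ k x).le_opNorm _).trans ?_)
    exact mul_le_mul hC hR (norm_nonneg _) ((norm_nonneg _).trans hC)
  rw [hs, map_sum] at hk'
  simp only [map_smul, smul_eq_mul, Fin.sum_univ_two] at hk'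
  simp only [Fin.sum_univ_two]
  rw [h2, h2]
  simp only [qb_fderiv]
  simp only [eb, EuclideanSpace.inner_single_right]
  simp [eb] at hk' ⊢
  linarith

lemma slice_x {v : E2 → ℝ → ℝ} (hv : ContDiff ℝ (⊤ : ℕ∞) (Function.uncurry v)) (t : ℝ) :
    ContDiff ℝ (⊤ : ℕ∞) (fun y => v y t) :=
  hv.comp (contDiff_id.prodMk contDiff_const)

lemma slice_t {v : E2 → ℝ → ℝ} (hv : ContDiff ℝ (⊤ : ℕ∞) (Function.uncurry v)) (x : E2) :
    ContDiff ℝ (⊤ : ℕ∞) (v x) :=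
  hv.comp (contDiff_const.prodMk contDiff_id)

lemma deriv_left_nonpos {p : ℝ → ℝ} {t : ℝ} (ht : 0 < t) (hp : DifferentiableAt ℝ p t)
    (h : ∀ s, 0 < s → s < t → p t ≤ p s) : deriv p t ≤ 0 := by
  have h1 := (hasDerivAt_iff_tendsto_slope_left_right.1 hp.hasDerivAt).1
  refine le_of_tendsto h1 ?_
  filter_upwards [Ioo_mem_nhdsLT ht] with s hs
  rw [slope_def_field]
  exact div_nonpos_of_nonneg_of_nonpos (sub_nonneg.2 (h s hs.1 hs.2)) (by linarith [hs.2])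

lemma max_principle
    (Ω : Set E2) (hΩo : IsOpen Ω) (hΩb : Bornology.IsBounded Ω) (hΩconv : Convex ℝ Ω)
    (T : ℝ)
    (k μ : E2 → ℝ) (k₁ k₂ : ℝ) (hk₁ : 0 < k₁)
    (hkbd : ∀ x ∈ closure Ω, k₁ ≤ k x ∧ k x ≤ k₂)
    (hkC1 : ContDiffOn ℝ 1 k (closure Ω))
    (hμ : ∀ x ∈ frontier Ω, 0 ≤ μ x)
    (c : E2 → ℝ) (hc : ∀ x ∈ Ω, 0 ≤ c x)
    (v : E2 → ℝ → ℝ) (hv : ContDiff ℝ (⊤ : ℕ∞) (Function.uncurry v))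
    (hpde : ∀ x ∈ Ω, ∀ t : ℝ, 0 < t → t ≤ T →
      0 ≤ deriv (v x) t + ellOp k (fun y => v y t) x + c x * v x t)
    (hic : ∀ x ∈ Ω, 0 ≤ v x 0)
    (hrob : ∀ x ∈ frontier Ω, ∀ ν : E2, ‖ν‖ = 1 →
      (∀ y ∈ closure Ω, (inner ℝ ν (y - x) : ℝ) ≤ 0) →
      ∀ t : ℝ, 0 < t → t ≤ T →
      k x * fderiv ℝ (fun y => v y t) x ν + μ x * v x t = 0) :
    ∀ x ∈ Ω, ∀ t, 0 ≤ t → t ≤ T → 0 ≤ v x t := by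
  intro x₀ hx₀ τ hτ0 hτT
  have hcomp : IsCompact (closure Ω) := hΩb.isCompact_closure
  have hdk : ∀ x ∈ Ω, DifferentiableAt ℝ k x := fun x hx =>
    (hkC1.differentiableOn (by norm_num)).differentiableAt
      (Filter.mem_of_superset (hΩo.mem_nhds hx) subset_closure)
  obtain ⟨C, hC⟩ : ∃ C, ∀ x ∈ Ω, ‖fderiv ℝ k x‖ ≤ C := by
    have hud : UniqueDiffOn ℝ (closure Ω) :=
      uniqueDiffOn_convex hΩconv.closure
        ⟨x₀, interior_mono subset_closure (by rwa [hΩo.interior_eq])⟩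
    obtain ⟨C, hC⟩ := hcomp.exists_bound_of_continuousOn
      (hkC1.continuousOn_fderivWithin hud le_rfl)
    refine ⟨C, fun x hx => ?_⟩
    have := hC x (subset_closure hx)
    rwa [fderivWithin_of_mem_nhds
      (Filter.mem_of_superset (hΩo.mem_nhds hx) subset_closure)] at this
  obtain ⟨R, hR⟩ : ∃ R, ∀ x ∈ Ω, ‖x - x₀‖ ≤ R := by
    obtain ⟨R, hR⟩ := hcomp.exists_bound_of_continuousOn
      (f := fun x : E2 => x - x₀) (by fun_prop)
    exact ⟨R, fun x hx => hR x (subset_closure hx)⟩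
  obtain ⟨M, hM0, hM⟩ : ∃ M : ℝ, 0 < M ∧ ∀ x ∈ Ω, -M < ellOp k (qb x₀) x := by
    refine ⟨max (2 * C * R + 4 * k₂) 0 + 1, by positivity, fun x hx => ?_⟩
    have := qb_ellOp_bound (hdk x hx) (hC x hx) (hR x hx) (hkbd x (subset_closure hx)).2
    have := le_max_left (2 * C * R + 4 * k₂) 0
    linarith
  have hqb0 : ∀ x, 0 ≤ qb x₀ x := fun x => by unfold qb; positivity
  -- perturbed function is nonnegative
  have key : ∀ ε : ℝ, 0 < ε → ∀ x ∈ closure Ω, ∀ t ∈ Set.Icc (0:ℝ) T,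
      0 ≤ (v x t + ε * qb x₀ x) + ε * M * t := by
    intro ε hε
    by_contra! hneg
    obtain ⟨xn, hxn, tn, htn, hWn⟩ := hneg
    have hcont : Continuous (fun p : E2 × ℝ => (v p.1 p.2 + ε * qb x₀ p.1) + ε * M * p.2) := by
      have h1 : Continuous (fun p : E2 × ℝ => v p.1 p.2) := hv.continuous
      have h2 : Continuous (qb x₀) := (qb_smooth x₀).continuous
      fun_prop
    obtain ⟨⟨x1, t1⟩, ⟨hx1, ht1⟩, hmin⟩ := (hcomp.prod (isCompact_Icc (a := (0:ℝ)) (b := T))).exists_isMinOn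
      ⟨(xn, tn), hxn, htn⟩ hcont.continuousOn
    simp only at hx1 ht1
    have hmin' : ∀ x ∈ closure Ω, ∀ t ∈ Set.Icc (0:ℝ) T,
        (v x1 t1 + ε * qb x₀ x1) + ε * M * t1 ≤ (v x t + ε * qb x₀ x) + ε * M * t :=
      fun x hx t ht => hmin (show (x, t) ∈ closure Ω ×ˢ Set.Icc (0:ℝ) T from ⟨hx, ht⟩)
    have hW1 : (v x1 t1 + ε * qb x₀ x1) + ε * M * t1 < 0 :=
      lt_of_le_of_lt (hmin' xn hxn tn htn) hWn
    have hq1 := mul_nonneg hε.le (hqb0 x1)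
    have hMt1 : 0 ≤ ε * M * t1 := mul_nonneg (mul_pos hε hM0).le ht1.1
    have hv1 : v x1 t1 < 0 := by linarith
    have hic' : 0 ≤ v x1 0 := by
      have hcl : closure Ω ⊆ {x | 0 ≤ v x 0} :=
        closure_minimal hic (isClosed_le continuous_const (slice_x hv 0).continuous)
      exact hcl hx1
    have ht1pos : 0 < t1 := by
      rcases ht1.1.lt_or_eq with h | h
      · exact h
      · subst h; linarith
    have hgs := slice_x hv t1
    have hgd : Differentiable ℝ (fun y => v y t1) := hgs.differentiable (by simp)
    have hqd : Differentiable ℝ (qb x₀) := (qb_smooth x₀).differentiable (by simp)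
    by_cases hxin : x1 ∈ Ω
    · -- interior
      have hkx := hkbd x1 hx1
      have hA : ellOp k (fun y => v y t1 + ε * qb x₀ y) x1 ≤ 0 := by
        refine ellOp_min (hdk x1 hxin) (by linarith)
          (hgs.add (contDiff_const.mul (qb_smooth x₀))) ?_
        filter_upwards [hΩo.mem_nhds hxin] with y hy
        have := hmin' y (subset_closure hy) t1 ht1
        linarith
      rw [ellOp_lin ε (hdk x1 hxin) hgs (qb_smooth x₀)] at hA
      have hvt : DifferentiableAt ℝ (v x1) t1 := (slice_t hv x1).differentiable (by simp) t1
      have hder : HasDerivAt (fun t => (v x1 t + ε * qb x₀ x1) + ε * M * t)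
          (deriv (v x1) t1 + ε * M) t1 := by
        have h := (hvt.hasDerivAt.add_const (ε * qb x₀ x1)).add
          ((hasDerivAt_id t1).const_mul (ε * M))
        rw [mul_one] at h
        exact h
      have hB := deriv_left_nonpos ht1pos hder.differentiableAt (fun s hs0 hs1 =>
        hmin' x1 hx1 s ⟨hs0.le, hs1.le.trans ht1.2⟩)
      rw [hder.deriv] at hB
      have hP := hpde x1 hxin t1 ht1pos ht1.2
      have hcv := mul_nonneg (hc x1 hxin) (neg_nonneg.2 hv1.le)
      have := mul_lt_mul_of_pos_left (hM x1 hxin) hε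
      nlinarith
    · -- boundary
      have hfr : x1 ∈ frontier Ω := by
        rw [hΩo.frontier_eq]; exact ⟨hx1, hxin⟩
      have hkx := hkbd x1 hx1
      obtain ⟨r, hr, hball⟩ := Metric.isOpen_iff.1 hΩo x₀ hx₀
      -- strict sign for the conormal derivative
      have hpos : ∀ ν : E2, ‖ν‖ = 1 →
          (∀ y ∈ closure Ω, (inner ℝ ν (y - x1) : ℝ) ≤ 0) →
          0 < fderiv ℝ (fun y => v y t1) x1 ν + ε * (2 * inner ℝ (x1 - x₀) ν) := by
        intro ν hν hN
        have h1 : (0:ℝ) < inner ℝ (x1 - x₀) ν := by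
          have hmem : x₀ + (r/2) • ν ∈ Ω := hball (by
            simp [norm_smul, hν, abs_of_pos hr]; linarith)
          have := hN _ (subset_closure hmem)
          have e : x₀ + (r/2) • ν - x1 = (r/2) • ν - (x1 - x₀) := by abel
          rw [e, inner_sub_right, inner_smul_right, real_inner_self_eq_norm_sq, hν,
            real_inner_comm] at this
          linarith
        have h2 := hrob x1 hfr ν hν hN t1 ht1pos ht1.2
        have h3 := mul_nonneg (hμ x1 hfr) (neg_nonneg.2 hv1.le)
        have h4 : 0 ≤ fderiv ℝ (fun y => v y t1) x1 ν := by
          by_contra! hlt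
          nlinarith [mul_pos (lt_of_lt_of_le hk₁ hkx.1) (neg_pos.2 hlt)]
        have := mul_pos hε h1
        linarith
      have hgF : HasFDerivAt (fun y => v y t1 + ε * qb x₀ y)
          (fderiv ℝ (fun y => v y t1) x1 + ε • fderiv ℝ (qb x₀) x1) x1 :=
        (hgd x1).hasFDerivAt.add ((hqd x1).hasFDerivAt.const_mul ε)
      set L := fderiv ℝ (fun y => v y t1) x1 + ε • fderiv ℝ (qb x₀) x1 with hL
      have hLa : ∀ ν, L ν = fderiv ℝ (fun y => v y t1) x1 ν + ε * (2 * inner ℝ (x1 - x₀) ν) := by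
        intro ν; simp [hL, qb_fderiv]
      have hLT : ∀ y ∈ closure Ω, 0 ≤ L (y - x1) := by
        intro y hy
        have hm : IsMinOn (fun y => v y t1 + ε * qb x₀ y) (closure Ω) x1 := by
          intro z hz
          have := hmin' z hz t1 ht1
          simp only [Set.mem_ofPred_eq]
          linarith
        exact hm.localize.hasFDerivWithinAt_nonneg hgF.hasFDerivWithinAt
          (sub_mem_posTangentConeAt_of_segment_subset
            (hΩconv.closure.segment_subset hx1 hy))
      set p : E2 := (InnerProductSpace.toDual ℝ E2).symm L with hp
      have hpL : ∀ d, inner ℝ p d = L d := by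
        intro d; simp [hp]
      by_cases hp0 : p = 0
      · -- some outward normal exists
        obtain ⟨F, hF⟩ := geometric_hahn_banach_open_point hΩconv hΩo hxin
        set q : E2 := (InnerProductSpace.toDual ℝ E2).symm F with hq
        have hqF : ∀ d, inner ℝ q d = F d := by
          intro d; simp [hq]
        have hq0 : q ≠ 0 := by
          intro h
          have h1 := hF x₀ hx₀
          rw [← hqF, ← hqF, h] at h1
          simp at h1
        have hqn : 0 < ‖q‖ := norm_pos_iff.2 hq0
        have hFc : closure Ω ⊆ {y | F y ≤ F x1} :=
          closure_minimal (fun y hy => (hF y hy).le)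
            (isClosed_le F.continuous continuous_const)
        have := hpos (‖q‖⁻¹ • q) (by rw [norm_smul, norm_inv, norm_norm, inv_mul_cancel₀ hqn.ne'])
          (by
            intro y hy
            rw [inner_smul_left, hqF, map_sub]
            have h1 : F y ≤ F x1 := hFc hy
            exact mul_nonpos_of_nonneg_of_nonpos (by simp) (by linarith))
        rw [← hLa, ← hpL, hp0] at this
        simp at this
      · have hpn : 0 < ‖p‖ := norm_pos_iff.2 hp0
        have := hpos (-(‖p‖⁻¹ • p))
          (by rw [norm_neg, norm_smul, norm_inv, norm_norm, inv_mul_cancel₀ hpn.ne'])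
          (by
            intro y hy
            rw [inner_neg_left, inner_smul_left, hpL]
            have h1 := hLT y hy
            have : 0 ≤ (‖p‖⁻¹) * L (y - x1) := by positivity
            simpa using this)
        rw [← hLa, ← hpL, inner_neg_right, inner_smul_right, real_inner_self_eq_norm_sq] at this
        have : 0 < ‖p‖⁻¹ * ‖p‖ ^ 2 := by positivity
        linarith
  have hlim : Filter.Tendsto (fun ε : ℝ => (v x₀ τ + ε * qb x₀ x₀) + ε * M * τ)
      (nhdsWithin 0 (Set.Ioi 0)) (nhds (v x₀ τ)) := by
    have : Continuous (fun ε : ℝ => (v x₀ τ + ε * qb x₀ x₀) + ε * M * τ) := by fun_prop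
    have h := this.tendsto 0
    simp only [zero_mul, add_zero] at h
    exact h.mono_left nhdsWithin_le_nhds
  refine ge_of_tendsto hlim ?_
  filter_upwards [self_mem_nhdsWithin] with ε hε
  exact key ε hε x₀ (subset_closure hx₀) τ ⟨hτ0, hτT⟩

/-- with `ψ(x) = u(x,T)`, the exact reaction coefficient satisfies the
upper bound `c(x) ψ(x) ≤ -(A ψ)(x) + f(x,T)` on `Ω`. -/
theorem coeff_upper_bound
    (Ω : Set E2) (hΩo : IsOpen Ω) (hΩb : Bornology.IsBounded Ω) (hΩconv : Convex ℝ Ω)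
    (T : ℝ) (hT : 0 < T)
    (k μ : E2 → ℝ) (k₁ k₂ : ℝ) (hk₁ : 0 < k₁)
    (hkbd : ∀ x ∈ closure Ω, k₁ ≤ k x ∧ k x ≤ k₂)
    (hkC1 : ContDiffOn ℝ 1 k (closure Ω))
    (hμ : ∀ x ∈ frontier Ω, 0 ≤ μ x)
    (f : E2 → ℝ → ℝ) (hf : ContDiff ℝ (⊤ : ℕ∞) (Function.uncurry f))
    (c : E2 → ℝ) (hc : ∀ x ∈ Ω, 0 ≤ c x)
    (u : E2 → ℝ → ℝ) (hureg : ContDiff ℝ (⊤ : ℕ∞) (Function.uncurry u))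
    (hu : IsDirectSolution Ω T k μ c f u)
    (hf0 : ∀ x ∈ Ω, f x 0 = 0)
    (hft : ∀ x ∈ Ω, ∀ t : ℝ, 0 ≤ t → t ≤ T → 0 < deriv (f x) t) :
    ∀ x ∈ Ω, c x * u x T ≤ - ellOp k (fun y => u y T) x + f x T := by
  have hdk : ∀ x ∈ Ω, DifferentiableAt ℝ k x := fun x hx =>
    (hkC1.differentiableOn (by norm_num)).differentiableAt
      (Filter.mem_of_superset (hΩo.mem_nhds hx) subset_closure)
  have hfmono : ∀ x ∈ Ω, StrictMonoOn (f x) (Set.Icc 0 T) := by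
    intro x hx
    refine strictMonoOn_of_deriv_pos (convex_Icc 0 T) (slice_t hf x).continuous.continuousOn ?_
    intro t ht
    rw [interior_Icc] at ht
    exact hft x hx t ht.1.le ht.2.le
  have hu0 : ∀ x ∈ Ω, ∀ t, 0 ≤ t → t ≤ T → 0 ≤ u x t := by
    refine max_principle Ω hΩo hΩb hΩconv T k μ k₁ k₂ hk₁ hkbd hkC1 hμ c hc u hureg ?_ ?_ hu.robin
    · intro x hx t ht0 htT
      rw [hu.pde x hx t ht0 htT, ← hf0 x hx]
      exact ((hfmono x hx).le_iff_le ⟨le_rfl, hT.le⟩ ⟨ht0.le, htT⟩).2 ht0.le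
    · intro x hx
      exact (hu.ic x hx).ge
  have hmono : ∀ h, 0 < h → h < T → ∀ x ∈ Ω, u x (T - h) ≤ u x T := by
    intro h hh hhT x hx
    have hsh : ContDiff ℝ (⊤ : ℕ∞) (Function.uncurry fun y t => u y (t + h)) :=
      hureg.comp (contDiff_fst.prodMk (contDiff_snd.add contDiff_const))
    have hvs : ContDiff ℝ (⊤ : ℕ∞)
        (Function.uncurry fun y t => u y (t + h) + (-1) * u y t) :=
      hsh.add (contDiff_const.mul hureg)
    have key := max_principle Ω hΩo hΩb hΩconv (T - h) k μ k₁ k₂ hk₁ hkbd hkC1 hμ c hc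
      (fun y t => u y (t + h) + (-1) * u y t) hvs ?_ ?_ ?_ x hx (T - h) (by linarith) le_rfl
    · simp only [sub_add_cancel] at key
      linarith
    · intro y hy t ht0 htT
      have h1 := hu.pde y hy t ht0 (by linarith)
      have h2 := hu.pde y hy (t + h) (by linarith) (by linarith)
      rw [ellOp_lin (-1) (hdk y hy) (slice_x hureg (t + h)) (slice_x hureg t)]
      have hd := (slice_t hureg y).differentiable (by simp)
      have e : deriv (fun t => u y (t + h) + (-1) * u y t) t
          = deriv (u y) (t + h) + (-1) * deriv (u y) t :=
        (((hd (t + h)).hasDerivAt.comp_add_const t h).add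
          ((hd t).hasDerivAt.const_mul (-1))).deriv
      rw [e]
      have h3 := ((hfmono y hy).le_iff_le (a := t) (b := t + h)
        ⟨ht0.le, by linarith⟩ ⟨by linarith, by linarith⟩).2 (by linarith)
      linarith
    · intro y hy
      have h1 := hu.ic y hy
      have h2 := hu0 y hy h hh.le hhT.le
      simp only [zero_add, h1]
      linarith
    · intro y hy ν hν hN t ht0 htT
      have h1 := hu.robin y hy ν hν hN t ht0 (by linarith)
      have h2 := hu.robin y hy ν hν hN (t + h) (by linarith) (by linarith)
      have d1 := (slice_x hureg t).differentiable (by simp) y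
      have d2 := (slice_x hureg (t + h)).differentiable (by simp) y
      have e : fderiv ℝ (fun y => u y (t + h) + (-1) * u y t) y = _ :=
        (d2.hasFDerivAt.add (d1.hasFDerivAt.const_mul (-1))).fderiv
      rw [e]
      simp
      linarith
  intro x hx
  have hP := hu.pde x hx T hT le_rfl
  have hd := (slice_t hureg x).differentiable (by simp) T
  have hneg := deriv_left_nonpos (p := fun t => - u x t) hT hd.neg (by
    intro s hs0 hsT
    have := hmono (T - s) (by linarith) (by linarith) x hx
    simp only [sub_sub_cancel] at this
    linarith)
  have e : deriv (fun t => - u x t) T = - deriv (u x) T := hd.hasDerivAt.neg.deriv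
  rw [e] at hneg
  linarith

end
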